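/- Let P ⊆ ℝ^d be a nonempty polytope whose support function f_P is computed by a rank-2 maxout network of size s. Then there exist nonempty polytopes Q, R ⊆ ℝ^d with P + Q = R (Minkowski sum) such that xc(Q) + xc(R) ≤ 4s. In other words, the virtual extension complexity vxc(P) = min{xc(Q) + xc(R) : Q, R polytopes with P + Q = R} satisfies vxc(P) ≤ 4·nnc(P), where nnc(P) is the minimum size of a rank-2 maxout network computing f_P. -/

import Mathlib

open Finset Pointwise

def IsPolytope {d : ℕ} (P : Set (Fin d → ℝ)) : Prop :=
  ∃ V : Finset (Fin d → ℝ), V.Nonempty ∧ P = convexHull ℝ (V : Set (Fin d → ℝ))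

noncomputable def suppFn {d : ℕ} (P : Set (Fin d → ℝ)) (c : Fin d → ℝ) : ℝ :=
  sSup ((fun x => ∑ m, c m * x m) '' P)

def HasExtFormOfSize {d : ℕ} (P : Set (Fin d → ℝ)) (m : ℕ) : Prop :=
  ∃ (e m' : ℕ) (A : Matrix (Fin m) (Fin e) ℝ) (b : Fin m → ℝ)
    (C : Matrix (Fin m') (Fin e) ℝ) (d' : Fin m' → ℝ)
    (π : (Fin e → ℝ) →ᵃ[ℝ] (Fin d → ℝ)),
    π '' {y | A.mulVec y ≤ b ∧ C.mulVec y = d'} = P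

noncomputable def xc {d : ℕ} (P : Set (Fin d → ℝ)) : ℕ :=
  sInf {m | HasExtFormOfSize P m}

def MaxoutComputes {d : ℕ} (k s : ℕ) (a : Fin s → Fin k → Fin d → ℝ)
    (w : Fin s → Fin k → Fin s → ℝ) (f : (Fin d → ℝ) → ℝ) : Prop :=
  ∃ (z : Fin s → (Fin d → ℝ) → ℝ) (hs : 0 < s),
    (∀ j x, IsGreatest (Set.range fun i : Fin k =>
        ∑ m, a j i m * x m +
        ∑ l ∈ Finset.univ.filter (fun l => l < j), w j i l * z l x) (z j x)) ∧
    f = z ⟨s - 1, Nat.sub_lt hs Nat.one_pos⟩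

def IsMaxoutNetwork {d : ℕ} (k s : ℕ) (f : (Fin d → ℝ) → ℝ) : Prop :=
  ∃ (a : Fin s → Fin k → Fin d → ℝ) (w : Fin s → Fin k → Fin s → ℝ),
    MaxoutComputes k s a w f

def IsMonotoneMaxoutNetwork {d : ℕ} (k s : ℕ) (f : (Fin d → ℝ) → ℝ) : Prop :=
  ∃ (a : Fin s → Fin k → Fin d → ℝ) (w : Fin s → Fin k → Fin s → ℝ),
    (∀ j i m, 0 ≤ a j i m) ∧ (∀ j i l, 0 ≤ w j i l) ∧ MaxoutComputes k s a w f

def epiSet {d : ℕ} (f : (Fin d → ℝ) → ℝ) : Set (Fin (d + 1) → ℝ) :=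
  {p | f (fun m => p m.castSucc) ≤ p (Fin.last d)}

def argmaxSet {d : ℕ} (c : Fin d → ℝ) (S : Set (Fin d → ℝ)) : Set (Fin d → ℝ) :=
  {x | x ∈ S ∧ ∀ y ∈ S, ∑ m, c m * y m ≤ ∑ m, c m * x m}

def iterFaces {d : ℕ} (c : Fin d → Fin d → ℝ) (S : Set (Fin d → ℝ)) : ℕ → Set (Fin d → ℝ)
  | 0 => S
  | i + 1 => if h : i < d then argmaxSet (c ⟨i, h⟩) (iterFaces c S i) else iterFaces c S i

noncomputable def vxc {d : ℕ} (P : Set (Fin d → ℝ)) : ℕ :=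
  sInf {m | ∃ Q R : Set (Fin d → ℝ), IsPolytope Q ∧ IsPolytope R ∧ P + Q = R ∧ m = xc Q + xc R}

def coneGen {d : ℕ} (S : Set (Fin d → ℝ)) : Set (Fin d → ℝ) :=
  ⋂₀ {K | S ⊆ K ∧ Convex ℝ K ∧ ∀ x ∈ K, ∀ t : ℝ, 0 < t → t • x ∈ K}

def polarCone {d : ℕ} (K : Set (Fin d → ℝ)) : Set (Fin d → ℝ) :=
  {z | ∀ y ∈ K, ∑ i, z i * y i ≤ 0}

namespace IsPolytope

variable {d : ℕ} {P Q : Set (Fin d → ℝ)}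

theorem of_finite {V : Set (Fin d → ℝ)} (hV : V.Finite) (hne : V.Nonempty) :
    IsPolytope (convexHull ℝ V) := by
  lift V to Finset (Fin d → ℝ) using hV
  exact ⟨V, by simpa using hne, rfl⟩

theorem singleton (x : Fin d → ℝ) : IsPolytope ({x} : Set (Fin d → ℝ)) :=
  ⟨{x}, by simp, by simp⟩

theorem add (hP : IsPolytope P) (hQ : IsPolytope Q) : IsPolytope (P + Q) := by
  obtain ⟨V, hV, rfl⟩ := hP
  obtain ⟨W, hW, rfl⟩ := hQ
  rw [← convexHull_add]
  exact of_finite (V.finite_toSet.add W.finite_toSet) (Set.Nonempty.add hV hW)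

theorem smul (hP : IsPolytope P) (t : ℝ) : IsPolytope (t • P) := by
  obtain ⟨V, hV, rfl⟩ := hP
  rw [← convexHull_smul]
  exact of_finite V.finite_toSet.smul_set (Set.Nonempty.smul_set hV)

theorem convexHull_union (hP : IsPolytope P) (hQ : IsPolytope Q) :
    IsPolytope (convexHull ℝ (P ∪ Q)) := by
  obtain ⟨V, hV, rfl⟩ := hP
  obtain ⟨W, hW, rfl⟩ := hQ
  rw [convexHull_convexHull_union_left, convexHull_convexHull_union_right]
  exact of_finite (V.finite_toSet.union W.finite_toSet) (Set.Nonempty.inl hV)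

theorem sum {ι : Type*} (s : Finset ι) {K : ι → Set (Fin d → ℝ)} (hK : ∀ l, IsPolytope (K l)) :
    IsPolytope (∑ l ∈ s, K l) :=
  Finset.sum_induction K IsPolytope (fun _ _ => add) (singleton 0) fun l _ => hK l

theorem convex (hP : IsPolytope P) : Convex ℝ P := by
  obtain ⟨V, -, rfl⟩ := hP
  exact convex_convexHull ℝ _

theorem nonempty (hP : IsPolytope P) : P.Nonempty := by
  obtain ⟨V, hV, rfl⟩ := hP
  simpa using hV

theorem isCompact (hP : IsPolytope P) : IsCompact P := by
  obtain ⟨V, -, rfl⟩ := hP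
  exact V.finite_toSet.isCompact_convexHull ℝ

end IsPolytope

/-- The linear functional `x ↦ cᵀ x`. -/
def dotFunctional {d : ℕ} (c : Fin d → ℝ) : (Fin d → ℝ) →ₗ[ℝ] ℝ :=
  ∑ m, c m • LinearMap.proj m

section suppFn

variable {d : ℕ} {P Q : Set (Fin d → ℝ)}

theorem dotFunctional_apply (c x : Fin d → ℝ) : dotFunctional c x = ∑ m, c m * x m := by
  simp [dotFunctional]

theorem suppFn_eq (P : Set (Fin d → ℝ)) (c : Fin d → ℝ) :
    suppFn P c = sSup (dotFunctional c '' P) := by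
  simp only [suppFn, dotFunctional_apply]

theorem IsPolytope.bddAbove_image (hP : IsPolytope P) (c : Fin d → ℝ) :
    BddAbove (dotFunctional c '' P) :=
  (hP.isCompact.image (dotFunctional c).continuous_of_finiteDimensional).bddAbove

theorem suppFn_singleton (a c : Fin d → ℝ) : suppFn {a} c = ∑ m, a m * c m := by
  simp [suppFn, mul_comm]

theorem suppFn_add (hP : IsPolytope P) (hQ : IsPolytope Q) (c : Fin d → ℝ) :
    suppFn (P + Q) c = suppFn P c + suppFn Q c := by
  simp only [suppFn_eq, Set.image_add]
  exact csSup_add (hP.nonempty.image _) (hP.bddAbove_image c) (hQ.nonempty.image _)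
    (hQ.bddAbove_image c)

theorem suppFn_smul (P : Set (Fin d → ℝ)) {t : ℝ} (ht : 0 ≤ t) (c : Fin d → ℝ) :
    suppFn (t • P) c = t * suppFn P c := by
  simp only [suppFn_eq, image_smul_set]
  exact Real.sSup_smul_of_nonneg ht _

theorem suppFn_sum {ι : Type*} (s : Finset ι) {K : ι → Set (Fin d → ℝ)}
    (hK : ∀ l, IsPolytope (K l)) (c : Fin d → ℝ) :
    suppFn (∑ l ∈ s, K l) c = ∑ l ∈ s, suppFn (K l) c := by
  classical
  induction s using Finset.induction_on with
  | empty =>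
    have := suppFn_singleton (0 : Fin d → ℝ) c
    simpa [← Set.singleton_zero] using this
  | insert l s hl ih =>
    rw [Finset.sum_insert hl, Finset.sum_insert hl, suppFn_add (hK l) (.sum s hK), ih]

theorem suppFn_convexHull_union (hP : IsPolytope P) (hQ : IsPolytope Q) (c : Fin d → ℝ) :
    suppFn (convexHull ℝ (P ∪ Q)) c = max (suppFn P c) (suppFn Q c) := by
  have key : upperBounds (dotFunctional c '' convexHull ℝ (P ∪ Q)) =
      upperBounds (dotFunctional c '' (P ∪ Q)) := by
    refine (upperBounds_mono_set (Set.image_mono (subset_convexHull ℝ _))).antisymm ?_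
    rintro v hv _ ⟨x, hx, rfl⟩
    refine convexHull_min (t := {y | dotFunctional c y ≤ v}) (fun y hy => ?_)
      (convex_halfSpace_le (dotFunctional c).isLinear v) hx
    exact hv ⟨y, hy, rfl⟩
  have hlub := isLUB_csSup ((hP.nonempty.inl : (P ∪ Q).Nonempty).image (dotFunctional c))
    (by rw [Set.image_union]; exact (hP.bddAbove_image c).union (hQ.bddAbove_image c))
  rw [suppFn_eq, suppFn_eq, suppFn_eq, ← csSup_union (hP.bddAbove_image c) (hP.nonempty.image _)
    (hQ.bddAbove_image c) (hQ.nonempty.image _), ← Set.image_union]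
  refine IsLUB.csSup_eq ?_ (((hP.nonempty.inl : (P ∪ Q).Nonempty).convexHull).image _)
  unfold IsLUB at hlub ⊢
  rwa [key]

theorem subset_of_suppFn_le (hP : IsPolytope P) (hQ : IsPolytope Q)
    (h : ∀ c, suppFn P c ≤ suppFn Q c) : P ⊆ Q := by
  intro x hx
  by_contra hxQ
  obtain ⟨f, u, hfQ, hfx⟩ := geometric_hahn_banach_closed_point hQ.convex hQ.isCompact.isClosed hxQ
  let c : Fin d → ℝ := fun i => f fun j => if i = j then 1 else 0
  have hf : ∀ y, dotFunctional c y = f y := by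
    intro y
    have := LinearMap.pi_apply_eq_sum_univ f.toLinearMap y
    simp only [dotFunctional_apply, c, mul_comm]
    simpa using this.symm
  have h1 : f x ≤ suppFn P c := by
    rw [suppFn_eq, ← hf]
    exact le_csSup (hP.bddAbove_image c) ⟨x, hx, rfl⟩
  have h2 : suppFn Q c ≤ u := by
    rw [suppFn_eq]
    refine csSup_le (hQ.nonempty.image _) ?_
    rintro _ ⟨y, hy, rfl⟩
    rw [hf]
    exact (hfQ y hy).le
  linarith [h c]

theorem eq_of_suppFn_eq (hP : IsPolytope P) (hQ : IsPolytope Q)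
    (h : ∀ c, suppFn P c = suppFn Q c) : P = Q :=
  (subset_of_suppFn_le hP hQ fun c => (h c).le).antisymm
    (subset_of_suppFn_le hQ hP fun c => (h c).ge)

end suppFn

/-- The polytopes attached to the neurons of a rank-2 maxout network with nonnegative weights
between neurons. -/
noncomputable def neuronPolytope {d : ℕ} (a : ℕ → Fin 2 → Fin d → ℝ) (w : ℕ → Fin 2 → ℕ → ℝ) :
    ℕ → Set (Fin d → ℝ)
  | j => convexHull ℝ (({a j 0} + ∑ l : Fin j, w j 0 l • neuronPolytope a w l) ∪
      ({a j 1} + ∑ l : Fin j, w j 1 l • neuronPolytope a w l))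

/-- The weighted Minkowski sum of the first `n` neuron polytopes. -/
noncomputable def neuronSum {d : ℕ} (a : ℕ → Fin 2 → Fin d → ℝ) (w : ℕ → Fin 2 → ℕ → ℝ)
    (n : ℕ) (c : ℕ → ℝ) : Set (Fin d → ℝ) :=
  ∑ l ∈ range n, c l • neuronPolytope a w l

section neuronPolytope

variable {d : ℕ} (a : ℕ → Fin 2 → Fin d → ℝ) (w : ℕ → Fin 2 → ℕ → ℝ)

theorem neuronPolytope_eq (j : ℕ) : neuronPolytope a w j =
    convexHull ℝ (({a j 0} + neuronSum a w j (w j 0)) ∪ ({a j 1} + neuronSum a w j (w j 1))) := by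
  rw [neuronPolytope, neuronSum, neuronSum, Finset.sum_range, Finset.sum_range]

theorem neuronSum_succ (n : ℕ) (c : ℕ → ℝ) :
    neuronSum a w (n + 1) c = neuronSum a w n c + c n • neuronPolytope a w n :=
  Finset.sum_range_succ _ _

theorem isPolytope_neuronPolytope (j : ℕ) : IsPolytope (neuronPolytope a w j) := by
  induction j using Nat.strong_induction_on with
  | _ j ih =>
    have h : ∀ i, IsPolytope ({a j i} + ∑ l : Fin j, w j i l • neuronPolytope a w l) := fun i =>
      (IsPolytope.singleton _).add (.sum _ fun l : Fin j => (ih l l.2).smul _)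
    rw [neuronPolytope]
    exact (h 0).convexHull_union (h 1)

theorem isPolytope_neuronSum (n : ℕ) (c : ℕ → ℝ) : IsPolytope (neuronSum a w n c) :=
  .sum _ fun l => (isPolytope_neuronPolytope a w l).smul _

theorem suppFn_neuronSum (n : ℕ) {c : ℕ → ℝ} (hc : ∀ l, 0 ≤ c l) (x : Fin d → ℝ) :
    suppFn (neuronSum a w n c) x = ∑ l ∈ range n, c l * suppFn (neuronPolytope a w l) x := by
  rw [neuronSum, suppFn_sum _ fun l => (isPolytope_neuronPolytope a w l).smul _]
  exact Finset.sum_congr rfl fun l _ => suppFn_smul _ (hc l) x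

theorem neuronSum_add_smul (n : ℕ) {c c' : ℕ → ℝ} {t : ℝ} (hc : ∀ l, 0 ≤ c l)
    (hc' : ∀ l, 0 ≤ c' l) (ht : 0 ≤ t) :
    neuronSum a w n (fun l => c l + t * c' l) = neuronSum a w n c + t • neuronSum a w n c' := by
  induction n with
  | zero => simp [neuronSum]
  | succ n ih =>
    rw [neuronSum_succ, neuronSum_succ, neuronSum_succ, ih, smul_add, smul_smul,
      (isPolytope_neuronPolytope a w n).convex.add_smul (hc n) (mul_nonneg ht (hc' n)),
      add_add_add_comm]

variable {w}

theorem suppFn_neuronPolytope (hw : ∀ j i l, 0 ≤ w j i l) (j : ℕ) (x : Fin d → ℝ) :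
    suppFn (neuronPolytope a w j) x =
      max (∑ m, a j 0 m * x m + ∑ l ∈ range j, w j 0 l * suppFn (neuronPolytope a w l) x)
        (∑ m, a j 1 m * x m + ∑ l ∈ range j, w j 1 l * suppFn (neuronPolytope a w l) x) := by
  have h : ∀ i, IsPolytope ({a j i} + neuronSum a w j (w j i)) := fun i =>
    (IsPolytope.singleton _).add (isPolytope_neuronSum a w _ _)
  rw [neuronPolytope_eq, suppFn_convexHull_union (h 0) (h 1),
    suppFn_add (.singleton _) (isPolytope_neuronSum a w _ _), suppFn_singleton,
    suppFn_neuronSum a w j (hw j 0), suppFn_add (.singleton _) (isPolytope_neuronSum a w _ _),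
    suppFn_singleton, suppFn_neuronSum a w j (hw j 1)]

theorem mem_neuronSum_succ (hw : ∀ j i l, 0 ≤ w j i l) (n : ℕ) {c : ℕ → ℝ} (hc : ∀ l, 0 ≤ c l)
    (x : Fin d → ℝ) :
    x ∈ neuronSum a w (n + 1) c ↔ ∃ u v : ℝ, 0 ≤ u ∧ 0 ≤ v ∧ u + v = c n ∧
      ∃ y ∈ neuronSum a w n (fun l => c l + u * w n 0 l + v * w n 1 l),
        x = y + (u • a n 0 + v • a n 1) := by
  have h : ∀ i, IsPolytope ({a n i} + neuronSum a w n (w n i)) := fun i =>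
    (IsPolytope.singleton _).add (isPolytope_neuronSum a w _ _)
  have split : ∀ u v : ℝ, 0 ≤ u → 0 ≤ v →
      neuronSum a w n (fun l => c l + u * w n 0 l + v * w n 1 l) =
        neuronSum a w n c + u • neuronSum a w n (w n 0) + v • neuronSum a w n (w n 1) := by
    intro u v hu hv
    rw [neuronSum_add_smul a w n (fun l => add_nonneg (hc l) (mul_nonneg hu (hw n 0 l))) (hw n 1) hv,
      neuronSum_add_smul a w n hc (hw n 0) hu]
  rw [neuronSum_succ]
  constructor
  · rintro ⟨y, hy, _, ⟨k, hk, rfl⟩, rfl⟩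
    rw [neuronPolytope_eq, (h 0).convex.convexHull_union (h 1).convex (h 0).nonempty
      (h 1).nonempty, mem_convexJoin] at hk
    obtain ⟨_, ⟨_, rfl, k₀, hk₀, rfl⟩, _, ⟨_, rfl, k₁, hk₁, rfl⟩, p, q, hp, hq, hpq, rfl⟩ := hk
    refine ⟨c n * p, c n * q, mul_nonneg (hc n) hp, mul_nonneg (hc n) hq,
      by rw [← mul_add, hpq, mul_one], y + (c n * p) • k₀ + (c n * q) • k₁, ?_, ?_⟩
    · rw [split _ _ (mul_nonneg (hc n) hp) (mul_nonneg (hc n) hq)]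
      exact Set.add_mem_add (Set.add_mem_add hy (Set.smul_mem_smul_set hk₀))
        (Set.smul_mem_smul_set hk₁)
    · module
  · rintro ⟨u, v, hu, hv, huv, y, hy, rfl⟩
    rw [split u v hu hv] at hy
    obtain ⟨_, ⟨y, hy, _, ⟨k₀, hk₀, rfl⟩, rfl⟩, _, ⟨k₁, hk₁, rfl⟩, rfl⟩ := hy
    refine ⟨y, hy, u • (a n 0 + k₀) + v • (a n 1 + k₁), ?_, by simp only []; module⟩
    rw [← huv, (isPolytope_neuronPolytope a w n).convex.add_smul hu hv, neuronPolytope_eq]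
    refine Set.add_mem_add (Set.smul_mem_smul_set (subset_convexHull ℝ _ (.inl ?_)))
      (Set.smul_mem_smul_set (subset_convexHull ℝ _ (.inr ?_)))
    · exact Set.add_mem_add rfl hk₀
    · exact Set.add_mem_add rfl hk₁

theorem mem_neuronSum_iff (hw : ∀ j i l, 0 ≤ w j i l) (hw₀ : ∀ j i l, j ≤ l → w j i l = 0) (n : ℕ)
    {c : ℕ → ℝ} (hc : ∀ l, 0 ≤ c l) (x : Fin d → ℝ) :
    x ∈ neuronSum a w n c ↔ ∃ μ : ℕ → Fin 2 → ℝ, (∀ l < n, ∀ i, 0 ≤ μ l i) ∧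
      (∀ l < n, ∑ i, μ l i = c l + ∑ j ∈ range n, ∑ i, μ j i * w j i l) ∧
      x = ∑ l ∈ range n, ∑ i, μ l i • a l i := by
  induction n generalizing c x with
  | zero => simp [neuronSum]
  | succ n ih =>
    rw [mem_neuronSum_succ a hw n hc]
    have hc' : ∀ u v : ℝ, 0 ≤ u → 0 ≤ v → ∀ l, 0 ≤ c l + u * w n 0 l + v * w n 1 l := by
      intro u v hu hv l
      have := hc l
      have := mul_nonneg hu (hw n 0 l)
      have := mul_nonneg hv (hw n 1 l)
      linarith
    have vanish : ∀ ν : ℕ → Fin 2 → ℝ, ∑ j ∈ range n, ∑ i, ν j i * w j i n = 0 := fun ν =>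
      Finset.sum_eq_zero fun j hj => Finset.sum_eq_zero fun i _ => by
        rw [hw₀ j i n (Finset.mem_range.1 hj).le, mul_zero]
    constructor
    · rintro ⟨u, v, hu, hv, huv, y, hy, rfl⟩
      obtain ⟨μ, hμ, hflow, rfl⟩ := (ih (hc' u v hu hv) y).1 hy
      have hne : ∀ l ∈ range n, Function.update μ n ![u, v] l = μ l := fun l hl =>
        Function.update_of_ne (Finset.mem_range.1 hl).ne _ _
      refine ⟨Function.update μ n ![u, v], ?_, ?_, ?_⟩
      · intro l hl i
        rcases Nat.lt_succ_iff_lt_or_eq.1 hl with hl | rfl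
        · rw [hne l (by simpa using hl)]
          exact hμ l hl i
        · fin_cases i <;> simpa
      · intro l hl
        rw [Finset.sum_range_succ]
        rcases Nat.lt_succ_iff_lt_or_eq.1 hl with hl | rfl
        · have hsum : ∑ j ∈ range n, ∑ i, Function.update μ n ![u, v] j i * w j i l =
              ∑ j ∈ range n, ∑ i, μ j i * w j i l :=
            Finset.sum_congr rfl fun j hj => by rw [hne j hj]
          rw [hsum, hne l (by simpa using hl), hflow l hl]
          simp [Fin.sum_univ_two]
          ring
        · rw [vanish]
          simpa [Fin.sum_univ_two, hw₀] using huv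
      · have hsum : ∑ j ∈ range n, ∑ i, Function.update μ n ![u, v] j i • a j i =
            ∑ j ∈ range n, ∑ i, μ j i • a j i :=
          Finset.sum_congr rfl fun j hj => by rw [hne j hj]
        rw [Finset.sum_range_succ, hsum]
        simp [Fin.sum_univ_two]
    · rintro ⟨μ, hμ, hflow, rfl⟩
      have hlast := hflow n n.lt_succ_self
      rw [Finset.sum_range_succ, vanish] at hlast
      refine ⟨μ n 0, μ n 1, hμ n n.lt_succ_self 0, hμ n n.lt_succ_self 1,
        by simpa [Fin.sum_univ_two, hw₀] using hlast, _,
        (ih (hc' _ _ (hμ n n.lt_succ_self 0) (hμ n n.lt_succ_self 1)) _).2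
          ⟨μ, fun l hl => hμ l (hl.trans n.lt_succ_self), fun l hl => ?_, rfl⟩, ?_⟩
      · rw [hflow l (hl.trans n.lt_succ_self), Finset.sum_range_succ]
        simp only [Fin.sum_univ_two]
        ring
      · rw [Finset.sum_range_succ]
        simp [Fin.sum_univ_two]

end neuronPolytope

/-- A linear image of `{y | 0 ≤ y, L y = c}` has an extended formulation with one inequality per
coordinate of `y`. -/
theorem hasExtFormOfSize_image {d : ℕ} {ι κ : Type*} [Fintype ι] [Fintype κ]
    (L : (ι → ℝ) →ₗ[ℝ] κ → ℝ) (c : κ → ℝ) (T : (ι → ℝ) →ₗ[ℝ] Fin d → ℝ) :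
    HasExtFormOfSize (T '' {y | 0 ≤ y ∧ L y = c}) (Fintype.card ι) := by
  classical
  let eι := Fintype.equivFin ι
  let eκ := Fintype.equivFin κ
  let F : (Fin (Fintype.card ι) → ℝ) ≃ₗ[ℝ] (ι → ℝ) := LinearEquiv.funCongrLeft ℝ ℝ eι
  let G : (κ → ℝ) ≃ₗ[ℝ] (Fin (Fintype.card κ) → ℝ) := LinearEquiv.funCongrLeft ℝ ℝ eκ.symm
  refine ⟨_, _, -1, 0, LinearMap.toMatrix' (G.toLinearMap ∘ₗ L ∘ₗ F.toLinearMap), G c,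
    (T ∘ₗ F.toLinearMap).toAffineMap, ?_⟩
  have hset : {y | (-1 : Matrix (Fin (Fintype.card ι)) (Fin (Fintype.card ι)) ℝ).mulVec y ≤ 0 ∧
      Matrix.mulVec (LinearMap.toMatrix' (G.toLinearMap ∘ₗ L ∘ₗ F.toLinearMap)) y = G c} =
      F ⁻¹' {y | 0 ≤ y ∧ L y = c} := by
    ext y
    have hnn : 0 ≤ F y ↔ 0 ≤ y := by
      constructor
      · intro h i
        simpa [F] using h (eι.symm i)
      · intro h i
        exact h (eι i)
    simp [LinearMap.toMatrix'_mulVec, Matrix.neg_mulVec, hnn]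
  rw [hset]
  ext x
  constructor
  · rintro ⟨y, hy, rfl⟩
    exact ⟨F y, hy, rfl⟩
  · rintro ⟨y, hy, rfl⟩
    exact ⟨F.symm y, by simpa using hy, by simp⟩

theorem xc_neuronSum_le {d : ℕ} (a : ℕ → Fin 2 → Fin d → ℝ) {w : ℕ → Fin 2 → ℕ → ℝ}
    (hw : ∀ j i l, 0 ≤ w j i l) (hw₀ : ∀ j i l, j ≤ l → w j i l = 0) (n : ℕ) {c : ℕ → ℝ}
    (hc : ∀ l, 0 ≤ c l) : xc (neuronSum a w n c) ≤ 2 * n := by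
  let L : (Fin n × Fin 2 → ℝ) →ₗ[ℝ] Fin n → ℝ := LinearMap.pi fun l =>
    ∑ i, LinearMap.proj (l, i) - ∑ j : Fin n, ∑ i, w j i l • LinearMap.proj (j, i)
  let T : (Fin n × Fin 2 → ℝ) →ₗ[ℝ] Fin d → ℝ :=
    ∑ l : Fin n, ∑ i, (LinearMap.proj (l, i) : (Fin n × Fin 2 → ℝ) →ₗ[ℝ] ℝ).smulRight (a l i)
  have hL : ∀ y l, L y l = ∑ i, y (l, i) - ∑ j : Fin n, ∑ i, y (j, i) * w j i l := by
    intro y l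
    simp [L, mul_comm]
  have hT : ∀ y, T y = ∑ l : Fin n, ∑ i, y (l, i) • a l i := by
    intro y
    simp [T]
  have key : neuronSum a w n c = T '' {y | 0 ≤ y ∧ L y = fun l : Fin n => c l} := by
    ext x
    rw [mem_neuronSum_iff a hw hw₀ n hc]
    constructor
    · rintro ⟨μ, hμ, hflow, rfl⟩
      refine ⟨fun p => μ p.1 p.2, ⟨fun p => hμ _ p.1.2 _, ?_⟩, ?_⟩
      · funext l
        rw [hL, hflow l l.2, Finset.sum_range]
        ring
      · rw [hT, Finset.sum_range]
    · rintro ⟨y, ⟨hy, hLy⟩, rfl⟩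
      refine ⟨fun l i => if h : l < n then y (⟨l, h⟩, i) else 0, ?_, ?_, ?_⟩
      · intro l hl i
        simpa [hl] using hy (⟨l, hl⟩, i)
      · intro l hl
        have := congrFun hLy ⟨l, hl⟩
        rw [hL] at this
        rw [Finset.sum_range]
        simp only [hl, Fin.is_lt, dite_true, Fin.eta]
        linarith
      · rw [hT, Finset.sum_range]
        simp
  refine Nat.sInf_le ?_
  have := hasExtFormOfSize_image L (fun l : Fin n => c l) T
  rw [← key] at this
  simpa [mul_comm] using this

/-- Writing each neuron of a network with weights `w` as a difference of support functions,
the coefficients of the subtracted part. -/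
noncomputable def subtrahendWeight (w : ℕ → Fin 2 → ℕ → ℝ) : ℕ → ℕ → ℝ
  | j => fun m => ∑ i, |w j i m - ∑ l : Fin j, w j i l * subtrahendWeight w l m|

/-- The weights of the monotone network computing the positive parts of the neurons. -/
noncomputable def minuendWeight (w : ℕ → Fin 2 → ℕ → ℝ) (j : ℕ) (i : Fin 2) (m : ℕ) : ℝ :=
  w j i m - ∑ l ∈ range j, w j i l * subtrahendWeight w l m + subtrahendWeight w j m

section decomposition

variable (w : ℕ → Fin 2 → ℕ → ℝ)

theorem subtrahendWeight_eq (j m : ℕ) : subtrahendWeight w j m =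
    ∑ i, |w j i m - ∑ l ∈ range j, w j i l * subtrahendWeight w l m| := by
  rw [subtrahendWeight]
  simp only [Finset.sum_range]

theorem subtrahendWeight_nonneg (j m : ℕ) : 0 ≤ subtrahendWeight w j m := by
  rw [subtrahendWeight_eq]
  positivity

theorem minuendWeight_nonneg (j : ℕ) (i : Fin 2) (m : ℕ) : 0 ≤ minuendWeight w j i m := by
  have h := Finset.single_le_sum
    (f := fun i => |w j i m - ∑ l ∈ range j, w j i l * subtrahendWeight w l m|)
    (fun _ _ => abs_nonneg _) (Finset.mem_univ i)
  rw [← subtrahendWeight_eq] at h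
  have h' := (abs_le.1 h).1
  rw [minuendWeight]
  linarith

variable {w}

theorem subtrahendWeight_eq_zero (hw₀ : ∀ j i l, j ≤ l → w j i l = 0) (j m : ℕ) (hjm : j ≤ m) :
    subtrahendWeight w j m = 0 := by
  induction j using Nat.strong_induction_on with
  | _ j ih =>
    rw [subtrahendWeight_eq]
    refine Finset.sum_eq_zero fun i _ => ?_
    rw [hw₀ j i m hjm, Finset.sum_eq_zero fun l hl => ?_, sub_zero, abs_zero]
    have hl := Finset.mem_range.1 hl
    rw [ih l hl (hl.le.trans hjm), mul_zero]

theorem minuendWeight_eq_zero (hw₀ : ∀ j i l, j ≤ l → w j i l = 0) (j : ℕ) (i : Fin 2) (m : ℕ)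
    (hjm : j ≤ m) : minuendWeight w j i m = 0 := by
  rw [minuendWeight, hw₀ j i m hjm, subtrahendWeight_eq_zero hw₀ j m hjm,
    Finset.sum_eq_zero fun l hl => ?_, sub_zero, add_zero]
  rw [subtrahendWeight_eq_zero hw₀ l m ((Finset.mem_range.1 hl).le.trans hjm), mul_zero]

/-- Each neuron of a rank-2 maxout network is a difference of a support function and a nonnegative
combination of earlier ones. -/
theorem neuron_eq_sub {d : ℕ} (a : ℕ → Fin 2 → Fin d → ℝ) (hw₀ : ∀ j i l, j ≤ l → w j i l = 0)
    {n : ℕ} {z : ℕ → ℝ} {x : Fin d → ℝ}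
    (hz : ∀ j < n, z j = max (∑ m, a j 0 m * x m + ∑ l ∈ range j, w j 0 l * z l)
      (∑ m, a j 1 m * x m + ∑ l ∈ range j, w j 1 l * z l)) (j : ℕ) (hj : j < n) :
    z j = suppFn (neuronPolytope a (minuendWeight w) j) x -
      ∑ m ∈ range j, subtrahendWeight w j m * suppFn (neuronPolytope a (minuendWeight w) m) x := by
  induction j using Nat.strong_induction_on with
  | _ j ih =>
    set h : ℕ → ℝ := fun m => suppFn (neuronPolytope a (minuendWeight w) m) x with hh
    have hext : ∀ l < j, ∑ m ∈ range l, subtrahendWeight w l m * h m =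
        ∑ m ∈ range j, subtrahendWeight w l m * h m := by
      intro l hl
      refine Finset.sum_subset (Finset.range_mono hl.le) fun m _ hm => ?_
      rw [subtrahendWeight_eq_zero hw₀ l m (by simpa using hm), zero_mul]
    have hsum : ∀ i, ∑ l ∈ range j, w j i l * z l =
        ∑ m ∈ range j, minuendWeight w j i m * h m -
          ∑ m ∈ range j, subtrahendWeight w j m * h m := by
      intro i
      have h1 : ∀ l ∈ range j, w j i l * z l = w j i l * h l -
          ∑ m ∈ range j, w j i l * subtrahendWeight w l m * h m := by
        intro l hl
        have hl := Finset.mem_range.1 hl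
        rw [ih l hl (hl.trans hj), hext l hl, mul_sub, Finset.mul_sum]
        simp only [mul_assoc]
        rfl
      rw [Finset.sum_congr rfl h1, Finset.sum_sub_distrib, Finset.sum_comm,
        ← Finset.sum_sub_distrib, ← Finset.sum_sub_distrib]
      refine Finset.sum_congr rfl fun m _ => ?_
      rw [minuendWeight, ← Finset.sum_mul]
      ring
    rw [hz j hj, hsum 0, hsum 1, suppFn_neuronPolytope a (minuendWeight_nonneg w), ← add_sub_assoc,
      ← add_sub_assoc, max_sub_sub_right]

end decomposition

theorem IsMaxoutNetwork.exists_nat_weights {d s : ℕ} {f : (Fin d → ℝ) → ℝ}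
    (hf : IsMaxoutNetwork 2 s f) :
    0 < s ∧ ∃ (a : ℕ → Fin 2 → Fin d → ℝ) (w : ℕ → Fin 2 → ℕ → ℝ) (z : ℕ → (Fin d → ℝ) → ℝ),
      (∀ j i l, j ≤ l → w j i l = 0) ∧
      (∀ x, ∀ j < s, z j x = max (∑ m, a j 0 m * x m + ∑ l ∈ range j, w j 0 l * z l x)
        (∑ m, a j 1 m * x m + ∑ l ∈ range j, w j 1 l * z l x)) ∧ f = z (s - 1) := by
  obtain ⟨a, w, z, hs, hz, rfl⟩ := hf
  refine ⟨hs, fun j i m => if h : j < s then a ⟨j, h⟩ i m else 0,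
    fun j i l => if h : l < j ∧ j < s then w ⟨j, h.2⟩ i ⟨l, h.1.trans h.2⟩ else 0,
    fun j => if h : j < s then z ⟨j, h⟩ else 0, ?_, ?_, by simp [hs]⟩
  · intro j i l hjl
    simp [hjl.not_gt]
  · intro x j hj
    have key : ∀ i, ∑ l ∈ range j,
        (if h : l < j ∧ j < s then w ⟨j, h.2⟩ i ⟨l, h.1.trans h.2⟩ else 0) *
          (if h : l < s then z ⟨l, h⟩ else 0) x =
        ∑ l ∈ Finset.univ.filter (fun l => l < (⟨j, hj⟩ : Fin s)), w ⟨j, hj⟩ i l * z l x := by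
      intro i
      symm
      refine Finset.sum_bij (fun l _ => (l : ℕ)) ?_ ?_ ?_ ?_
      · intro l hl
        simpa [Fin.lt_def] using hl
      · intro l _ l' _ h
        exact Fin.ext h
      · intro l hl
        have hl := Finset.mem_range.1 hl
        exact ⟨⟨l, hl.trans hj⟩, by simpa [Fin.lt_def] using hl, rfl⟩
      · intro l hl
        have hl : (l : ℕ) < j := by simpa [Fin.lt_def] using hl
        simp [hl, hj]
    have h := hz ⟨j, hj⟩ x
    simp only [key, dif_pos hj]
    refine le_antisymm ?_ (max_le (h.2 ⟨0, rfl⟩) (h.2 ⟨1, rfl⟩))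
    obtain ⟨i, hi⟩ := h.1
    rw [← hi]
    fin_cases i
    · exact le_max_left _ _
    · exact le_max_right _ _

/-- If the support function of a nonempty polytope `P ⊆ ℝ^d` is computed by a
rank-2 maxout network of size `s`, then there are nonempty polytopes `Q, R` with `P + Q = R`
and `xc Q + xc R ≤ 4 s`; in particular `vxc P ≤ 4 s = 4 · nnc P`. -/
theorem vxc_le_four_nnc {d s : ℕ} (P : Set (Fin d → ℝ)) (hP : IsPolytope P)
    (hf : IsMaxoutNetwork 2 s (suppFn P)) :
    (∃ Q R : Set (Fin d → ℝ), IsPolytope Q ∧ IsPolytope R ∧ P + Q = R ∧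
      xc Q + xc R ≤ 4 * s) ∧ vxc P ≤ 4 * s := by
  have main : ∃ Q R : Set (Fin d → ℝ), IsPolytope Q ∧ IsPolytope R ∧ P + Q = R ∧
      xc Q + xc R ≤ 4 * s := by
    obtain ⟨hs, a, w, z, hw₀, hz, hPz⟩ := hf.exists_nat_weights
    obtain ⟨n, rfl⟩ : ∃ n, s = n + 1 := ⟨s - 1, by omega⟩
    let e : ℕ → ℝ := fun l => if l = n then 1 else 0
    have he : ∀ l, 0 ≤ e l := fun l => by simp only [e]; split_ifs <;> norm_num
    have hnonneg := minuendWeight_nonneg w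
    have hzero := minuendWeight_eq_zero hw₀
    have hQ := isPolytope_neuronSum a (minuendWeight w) n (subtrahendWeight w n)
    have hR := isPolytope_neuronSum a (minuendWeight w) (n + 1) e
    refine ⟨_, _, hQ, hR, eq_of_suppFn_eq (hP.add hQ) hR fun x => ?_, ?_⟩
    · rw [suppFn_add hP hQ, suppFn_neuronSum _ _ _ (subtrahendWeight_nonneg w n),
        suppFn_neuronSum _ _ _ he, hPz,
        neuron_eq_sub a hw₀ (z := fun j => z j x) (hz x) (n + 1 - 1) (by omega)]
      simp [e]
    · have h1 := xc_neuronSum_le a hnonneg hzero n (subtrahendWeight_nonneg w n)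
      have h2 := xc_neuronSum_le a hnonneg hzero (n + 1) he
      omega
  refine ⟨main, ?_⟩
  obtain ⟨Q, R, hQ, hR, hPQ, hle⟩ := main
  have hvxc : vxc P ≤ xc Q + xc R := Nat.sInf_le ⟨Q, R, hQ, hR, hPQ, rfl⟩
  exact hvxc.trans hle
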